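/- Let $G=(V,E)$ be a finite connected simple graph with $n\ge 2$ vertices, and let $P$ be the transition matrix of the lazy random walk on $G$, that is, $P(u,u)=\frac12$, $P(u,v)=\frac{1}{2\deg(u)}$ if $\{u,v\}\in E$, and $P(u,v)=0$ otherwise. Let $1=\lambda_1>\lambda_2\ge\dots\ge\lambda_n\ge 0$ be the eigenvalues of $P$, repeated according to multiplicity, and let $t_{\mathrm{rel}}=\left\lceil \frac{1}{1-\lambda_2}\right\rceil$ be the relaxation time. Then for every integer $t\ge 1$, $$\sum_{i,j=0}^{t-1}\sum_{u\in V}P^{i+j}(u,u)\;\le\; t^2+\frac{t_{\mathrm{rel}}}{(1-1/e)^2}\sum_{s=0}^{t_{\mathrm{rel}}-1}\left(\sum_{u\in V}P^{s}(u,u)-1\right).$$ -/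

import Mathlib

/-- The transition matrix of the lazy random walk on `G`: `P(u,u) = 1/2`,
`P(u,v) = 1/(2 deg u)` if `u` and `v` are adjacent, and `P(u,v) = 0` otherwise. -/
noncomputable def lazyP {V : Type*} [Fintype V] [DecidableEq V]
    (G : SimpleGraph V) [DecidableRel G.Adj] : Matrix V V ℝ :=
  Matrix.of fun u v =>
    if u = v then 1 / 2
    else if G.Adj u v then 1 / (2 * (G.degree u : ℝ)) else 0

/-- The real eigenvalues of a square matrix, listed in decreasing order
`λ₁ ≥ λ₂ ≥ …` and repeated according to their multiplicity. -/
noncomputable def eigenvalueList {V : Type*} [Fintype V] [DecidableEq V]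
    (P : Matrix V V ℝ) : List ℝ :=
  P.charpoly.roots.sort (· ≥ ·)

/-- The second largest eigenvalue `λ₂`, counted with multiplicity
(the entry of index `1`, as lists are indexed from `0`; the default value `0` is only
used if there are fewer than two eigenvalues). -/
noncomputable def secondEig {V : Type*} [Fintype V] [DecidableEq V]
    (P : Matrix V V ℝ) : ℝ :=
  (eigenvalueList P).getD 1 0

/-- The relaxation time `t_rel = ⌈1 / (1 - λ₂)⌉`. -/
noncomputable def relTime {V : Type*} [Fintype V] [DecidableEq V]
    (P : Matrix V V ℝ) : ℕ :=
  ⌈1 / (1 - secondEig P)⌉₊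

open Matrix Finset

section Spectral

variable {n : Type*} [Fintype n] [DecidableEq n]

/-- The trace of a power of a real symmetric matrix is the power sum of the eigenvalues. -/
theorem Matrix.IsHermitian.trace_pow_eq_sum_eigenvalues {A : Matrix n n ℝ} (hA : A.IsHermitian)
    (k : ℕ) : (A ^ k).trace = ∑ i, hA.eigenvalues i ^ k := by
  have h : A ^ k = Unitary.conjStarAlgAut ℝ _ hA.eigenvectorUnitary
      (diagonal (fun i => hA.eigenvalues i ^ k)) := by
    conv_lhs => rw [hA.spectral_theorem]
    rw [← map_pow, diagonal_pow]
    rfl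
  rw [h, Unitary.conjStarAlgAut_apply, trace_mul_cycle, Unitary.coe_star_mul_self, one_mul,
    trace_diagonal]

end Spectral

section LazyWalk

variable {V : Type*} [Fintype V] (G : SimpleGraph V) [DecidableRel G.Adj]

theorem sum_adj_sq_left (y : V → ℝ) :
    (∑ u, ∑ v, if G.Adj u v then y u ^ 2 else 0) = ∑ u, (G.degree u : ℝ) * y u ^ 2 := by
  refine sum_congr rfl fun u _ => ?_
  rw [← sum_filter, sum_const, ← SimpleGraph.neighborFinset_eq_filter,
    SimpleGraph.card_neighborFinset_eq_degree, nsmul_eq_mul]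

theorem sum_adj_sq_right (y : V → ℝ) :
    (∑ u, ∑ v, if G.Adj u v then y v ^ 2 else 0) = ∑ u, (G.degree u : ℝ) * y u ^ 2 := by
  rw [sum_comm, ← sum_adj_sq_left]
  simp only [G.adj_comm]

variable {G}

theorem sum_degree_mul_sq_pos (hd : ∀ u, 0 < G.degree u) {y : V → ℝ} (hy : y ≠ 0) :
    0 < ∑ u, (G.degree u : ℝ) * y u ^ 2 := by
  obtain ⟨u, hu⟩ := Function.ne_iff.mp hy
  refine sum_pos' (fun v _ => by positivity) ⟨u, mem_univ u, ?_⟩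
  have : (0 : ℝ) < G.degree u := by exact_mod_cast hd u
  have : y u ≠ 0 := hu
  positivity

theorem sqrt_degree_pos (hd : ∀ u, 0 < G.degree u) (u : V) : 0 < √(G.degree u : ℝ) :=
  Real.sqrt_pos.2 (by exact_mod_cast hd u)

variable [DecidableEq V] (G)

theorem degree_mul_lazyP_mulVec (hd : ∀ u, 0 < G.degree u) (y : V → ℝ) (u : V) :
    (G.degree u : ℝ) * (lazyP G *ᵥ y) u =
      (G.degree u : ℝ) * y u / 2 + (∑ v, if G.Adj u v then y v else 0) / 2 := by
  have hu : (G.degree u : ℝ) ≠ 0 := by exact_mod_cast (hd u).ne'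
  have h : ∀ v, (G.degree u : ℝ) * (lazyP G u v * y v) =
      (if u = v then (G.degree u : ℝ) * y v / 2 else 0) +
        (if G.Adj u v then y v else 0) / 2 := by
    intro v
    by_cases huv : u = v
    · subst huv
      simp [lazyP]
      ring
    · by_cases ha : G.Adj u v
      · simp [lazyP, huv, ha]
        field_simp
      · simp [lazyP, huv, ha]
  simp only [mulVec, dotProduct]
  rw [mul_sum, sum_congr rfl fun v _ => h v, sum_add_distrib, sum_ite_eq, ← sum_div]
  simp

theorem lazyP_mulVec_one (hd : ∀ u, 0 < G.degree u) : lazyP G *ᵥ 1 = 1 := by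
  ext u
  have hu : (G.degree u : ℝ) ≠ 0 := by exact_mod_cast (hd u).ne'
  apply mul_left_cancel₀ hu
  rw [degree_mul_lazyP_mulVec G hd]
  have : (∑ v, if G.Adj u v then (1 : V → ℝ) v else 0) = G.degree u := by
    simp [← SimpleGraph.card_neighborFinset_eq_degree, SimpleGraph.neighborFinset_eq_filter]
  rw [this]
  simp

variable {G}

theorem sum_adj_mul_of_eigenvector (hd : ∀ u, 0 < G.degree u) {y : V → ℝ} {μ : ℝ}
    (hy : lazyP G *ᵥ y = μ • y) :
    (∑ u, ∑ v, if G.Adj u v then y u * y v else 0) =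
      (2 * μ - 1) * ∑ u, (G.degree u : ℝ) * y u ^ 2 := by
  rw [mul_sum]
  refine sum_congr rfl fun u _ => ?_
  have h := degree_mul_lazyP_mulVec G hd y u
  rw [hy, Pi.smul_apply, smul_eq_mul] at h
  have h' : (∑ v, if G.Adj u v then y u * y v else 0) =
      y u * ∑ v, if G.Adj u v then y v else 0 := by
    rw [mul_sum]
    simp only [mul_ite, mul_zero]
  rw [h']
  linear_combination (-2 * y u) * h

theorem sum_adj_add_sq_of_eigenvector (hd : ∀ u, 0 < G.degree u) {y : V → ℝ} {μ : ℝ}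
    (hy : lazyP G *ᵥ y = μ • y) :
    (∑ u, ∑ v, if G.Adj u v then (y u + y v) ^ 2 else 0) =
      4 * μ * ∑ u, (G.degree u : ℝ) * y u ^ 2 := by
  have h : ∀ u v, (if G.Adj u v then (y u + y v) ^ 2 else 0) =
      (if G.Adj u v then y u ^ 2 else 0) + (if G.Adj u v then y v ^ 2 else 0) +
        2 * (if G.Adj u v then y u * y v else 0) := by
    intro u v
    split_ifs <;> ring
  simp only [h, sum_add_distrib, ← mul_sum]
  rw [sum_adj_sq_left, sum_adj_sq_right, sum_adj_mul_of_eigenvector hd hy]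
  ring

theorem sum_adj_sub_sq_of_eigenvector (hd : ∀ u, 0 < G.degree u) {y : V → ℝ} {μ : ℝ}
    (hy : lazyP G *ᵥ y = μ • y) :
    (∑ u, ∑ v, if G.Adj u v then (y u - y v) ^ 2 else 0) =
      4 * (1 - μ) * ∑ u, (G.degree u : ℝ) * y u ^ 2 := by
  have h : ∀ u v, (if G.Adj u v then (y u - y v) ^ 2 else 0) =
      (if G.Adj u v then y u ^ 2 else 0) + (if G.Adj u v then y v ^ 2 else 0) +
        (-2) * (if G.Adj u v then y u * y v else 0) := by
    intro u v
    split_ifs <;> ring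
  simp only [h, sum_add_distrib, ← mul_sum]
  rw [sum_adj_sq_left, sum_adj_sq_right, sum_adj_mul_of_eigenvector hd hy]
  ring

theorem lazyP_eigenvalue_nonneg (hd : ∀ u, 0 < G.degree u) {y : V → ℝ} {μ : ℝ}
    (hy : lazyP G *ᵥ y = μ • y) (hy0 : y ≠ 0) : 0 ≤ μ := by
  have h := sum_adj_add_sq_of_eigenvector hd hy
  have hp := sum_degree_mul_sq_pos hd hy0
  have : 0 ≤ ∑ u, ∑ v, if G.Adj u v then (y u + y v) ^ 2 else 0 :=
    sum_nonneg fun u _ => sum_nonneg fun v _ => by split_ifs <;> positivity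
  rw [h] at this
  linarith [nonneg_of_mul_nonneg_left this hp]

theorem lazyP_eigenvalue_le_one (hd : ∀ u, 0 < G.degree u) {y : V → ℝ} {μ : ℝ}
    (hy : lazyP G *ᵥ y = μ • y) (hy0 : y ≠ 0) : μ ≤ 1 := by
  have h := sum_adj_sub_sq_of_eigenvector hd hy
  have hp := sum_degree_mul_sq_pos hd hy0
  have : 0 ≤ ∑ u, ∑ v, if G.Adj u v then (y u - y v) ^ 2 else 0 :=
    sum_nonneg fun u _ => sum_nonneg fun v _ => by split_ifs <;> positivity
  rw [h] at this
  linarith [nonneg_of_mul_nonneg_left this hp]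

/-- Harmonic functions of the lazy random walk on a connected graph are constant. -/
theorem eq_of_lazyP_mulVec_eq_self (hG : G.Connected) (hd : ∀ u, 0 < G.degree u) {y : V → ℝ}
    (hy : lazyP G *ᵥ y = y) (u v : V) : y u = y v := by
  have h := sum_adj_sub_sq_of_eigenvector (μ := 1) hd (by rwa [one_smul])
  rw [sub_self, mul_zero, zero_mul] at h
  have hn : ∀ a b, 0 ≤ if G.Adj a b then (y a - y b) ^ 2 else 0 := fun a b => by
    split_ifs <;> positivity
  have hadj : ∀ a b, G.Adj a b → y a = y b := by
    intro a b hab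
    have h1 := (sum_eq_zero_iff_of_nonneg fun a _ => sum_nonneg fun b _ => hn a b).1 h a
      (mem_univ a)
    have h2 := (sum_eq_zero_iff_of_nonneg fun b _ => hn a b).1 h1 b (mem_univ b)
    rw [if_pos hab] at h2
    linarith [pow_eq_zero_iff (two_ne_zero) |>.1 h2]
  obtain ⟨p⟩ := hG.preconnected u v
  induction p with
  | nil => rfl
  | cons hab _ ih => exact (hadj _ _ hab).trans ih

variable (G)

/-- The symmetrization `D^{1/2} P D^{-1/2}` of the lazy random walk. -/
noncomputable def symLazyP : Matrix V V ℝ :=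
  diagonal (fun u => √(G.degree u : ℝ)) * lazyP G * diagonal (fun u => (√(G.degree u : ℝ))⁻¹)

theorem symLazyP_isHermitian : (symLazyP G).IsHermitian := by
  ext u v
  simp only [symLazyP, conjTranspose_apply, star_trivial, mul_diagonal, diagonal_mul]
  by_cases huv : u = v
  · rw [huv]
  · by_cases ha : G.Adj u v
    · have hu : 0 < (G.degree u : ℝ) := by
        exact_mod_cast (G.degree_pos_iff_exists_adj u).2 ⟨v, ha⟩
      have hv : 0 < (G.degree v : ℝ) := by
        exact_mod_cast (G.degree_pos_iff_exists_adj v).2 ⟨u, ha.symm⟩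
      simp only [lazyP, of_apply, huv, Ne.symm huv, ha, ha.symm, if_true, if_false]
      have hu' := Real.sqrt_pos.2 hu
      have hv' := Real.sqrt_pos.2 hv
      field_simp
      rw [Real.sq_sqrt hu.le, Real.sq_sqrt hv.le]
    · have ha' : ¬ G.Adj v u := fun h => ha h.symm
      simp [lazyP, huv, Ne.symm huv, ha, ha']

variable {G}

theorem diagonal_sqrt_mul_inv (hd : ∀ u, 0 < G.degree u) :
    diagonal (fun u => √(G.degree u : ℝ)) * diagonal (fun u => (√(G.degree u : ℝ))⁻¹) = 1 := by
  rw [diagonal_mul_diagonal, ← diagonal_one]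
  congr 1
  ext u
  exact mul_inv_cancel₀ (sqrt_degree_pos hd u).ne'

theorem diagonal_inv_mul_sqrt (hd : ∀ u, 0 < G.degree u) :
    diagonal (fun u => (√(G.degree u : ℝ))⁻¹) * diagonal (fun u => √(G.degree u : ℝ)) = 1 :=
  mul_eq_one_comm.1 (diagonal_sqrt_mul_inv hd)

/-- The diagonal matrix `D^{1/2}` as a unit. -/
noncomputable def sqrtDegreeUnit (hd : ∀ u, 0 < G.degree u) : (Matrix V V ℝ)ˣ :=
  ⟨_, _, diagonal_sqrt_mul_inv hd, diagonal_inv_mul_sqrt hd⟩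

theorem symLazyP_eq_conj (hd : ∀ u, 0 < G.degree u) :
    symLazyP G = (sqrtDegreeUnit hd).val * lazyP G * (sqrtDegreeUnit hd)⁻¹.val := rfl

theorem charpoly_lazyP_eq (hd : ∀ u, 0 < G.degree u) :
    (lazyP G).charpoly = (symLazyP G).charpoly := by
  rw [symLazyP_eq_conj hd, coe_units_inv, charpoly_units_conj]

theorem trace_lazyP_pow_eq (hd : ∀ u, 0 < G.degree u) (k : ℕ) :
    (lazyP G ^ k).trace = (symLazyP G ^ k).trace := by
  rw [symLazyP_eq_conj hd, Units.conj_pow, trace_units_conj]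

theorem roots_charpoly_lazyP (hd : ∀ u, 0 < G.degree u) :
    (lazyP G).charpoly.roots = univ.val.map (symLazyP_isHermitian G).eigenvalues := by
  rw [charpoly_lazyP_eq hd, (symLazyP_isHermitian G).roots_charpoly_eq_eigenvalues]
  rfl

theorem sum_lazyP_pow_diag (hd : ∀ u, 0 < G.degree u) (k : ℕ) :
    ∑ u, (lazyP G ^ k) u u = ((lazyP G).charpoly.roots.map (· ^ k)).sum := by
  rw [roots_charpoly_lazyP hd, Multiset.map_map]
  exact (trace_lazyP_pow_eq hd k).trans
    ((symLazyP_isHermitian G).trace_pow_eq_sum_eigenvalues k)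

/-- Rescaling an eigenvector of the symmetrization gives an eigenvector of the walk. -/
theorem lazyP_mulVec_of_symLazyP (hd : ∀ u, 0 < G.degree u) {w : V → ℝ} {μ : ℝ}
    (hw : symLazyP G *ᵥ w = μ • w) :
    lazyP G *ᵥ (fun u => (√(G.degree u : ℝ))⁻¹ * w u) =
      μ • (fun u => (√(G.degree u : ℝ))⁻¹ * w u) := by
  have hdiag : (fun u => (√(G.degree u : ℝ))⁻¹ * w u) =
      diagonal (fun u => (√(G.degree u : ℝ))⁻¹) *ᵥ w := by
    ext u
    rw [mulVec_diagonal]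
  rw [hdiag, ← mulVec_smul, ← hw, symLazyP, mulVec_mulVec, mulVec_mulVec, ← mul_assoc,
    ← mul_assoc, diagonal_inv_mul_sqrt hd, one_mul]

theorem symLazyP_eigenvalue_exists (hd : ∀ u, 0 < G.degree u) (i : V) :
    ∃ y : V → ℝ, y ≠ 0 ∧ lazyP G *ᵥ y = (symLazyP_isHermitian G).eigenvalues i • y ∧
      ∀ u, (symLazyP_isHermitian G).eigenvectorBasis i u = √(G.degree u : ℝ) * y u := by
  have hw := (symLazyP_isHermitian G).mulVec_eigenvectorBasis i
  have hval : ∀ u, (symLazyP_isHermitian G).eigenvectorBasis i u = √(G.degree u : ℝ) *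
      ((√(G.degree u : ℝ))⁻¹ * (symLazyP_isHermitian G).eigenvectorBasis i u) := fun u => by
    rw [mul_inv_cancel_left₀ (sqrt_degree_pos hd u).ne']
  refine ⟨_, fun h0 => ?_, lazyP_mulVec_of_symLazyP hd hw, hval⟩
  apply (symLazyP_isHermitian G).eigenvectorBasis.orthonormal.ne_zero i
  ext u
  rw [hval u]
  have := congrFun h0 u
  simp only [Pi.zero_apply] at this
  rw [this, mul_zero]
  rfl

/-- The eigenvalue `1` of the lazy random walk on a connected graph is simple. -/
theorem symLazyP_eigenvalue_one_unique (hG : G.Connected) (hd : ∀ u, 0 < G.degree u) {i j : V}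
    (hi : (symLazyP_isHermitian G).eigenvalues i = 1)
    (hj : (symLazyP_isHermitian G).eigenvalues j = 1) : i = j := by
  by_contra hij
  obtain ⟨y, hy0, hy, hyw⟩ := symLazyP_eigenvalue_exists hd i
  obtain ⟨z, hz0, hz, hzw⟩ := symLazyP_eigenvalue_exists hd j
  rw [hi, one_smul] at hy
  rw [hj, one_smul] at hz
  have hyc := eq_of_lazyP_mulVec_eq_self hG hd hy
  have hzc := eq_of_lazyP_mulVec_eq_self hG hd hz
  obtain ⟨a, ha⟩ := Function.ne_iff.mp hy0
  obtain ⟨b, hb⟩ := Function.ne_iff.mp hz0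
  have horth := (symLazyP_isHermitian G).eigenvectorBasis.orthonormal.inner_eq_zero hij
  rw [PiLp.inner_apply] at horth
  have hterm : ∀ u, inner ℝ ((symLazyP_isHermitian G).eigenvectorBasis i u)
      ((symLazyP_isHermitian G).eigenvectorBasis j u) = (G.degree u : ℝ) * (y a * z b) := by
    intro u
    rw [hyw, hzw, hyc u a, hzc u b]
    simp only [RCLike.inner_apply, conj_trivial]
    linear_combination (y a * z b) * Real.mul_self_sqrt (Nat.cast_nonneg (α := ℝ) (G.degree u))
  rw [sum_congr rfl fun u _ => hterm u, ← sum_mul] at horth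
  have hpos : 0 < ∑ u, (G.degree u : ℝ) :=
    sum_pos (fun u _ => by exact_mod_cast hd u) ⟨a, mem_univ a⟩
  exact mul_ne_zero hpos.ne' (mul_ne_zero ha hb) horth

theorem one_mem_roots_charpoly_lazyP [Nonempty V] (hd : ∀ u, 0 < G.degree u) :
    (1 : ℝ) ∈ (lazyP G).charpoly.roots := by
  rw [Polynomial.mem_roots (charpoly_monic _).ne_zero, Polynomial.IsRoot, eval_charpoly]
  refine exists_mulVec_eq_zero_iff.1 ⟨1, one_ne_zero, ?_⟩
  rw [sub_mulVec, lazyP_mulVec_one G hd, map_one, one_mulVec, sub_self]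

/-- The eigenvalue list of the lazy random walk is `1, λ₂, …` with `λ₂ < 1`, and every further
eigenvalue lies in `[0, λ₂]`. -/
theorem roots_charpoly_lazyP_eq_cons [Nontrivial V] (hG : G.Connected) :
    ∃ s : Multiset ℝ, (lazyP G).charpoly.roots = 1 ::ₘ s ∧ secondEig (lazyP G) < 1 ∧
      ∀ μ ∈ s, 0 ≤ μ ∧ μ ≤ secondEig (lazyP G) := by
  have hd : ∀ u, 0 < G.degree u := fun u => hG.preconnected.degree_pos_of_nontrivial u
  have hroots := roots_charpoly_lazyP hd
  have hbound : ∀ μ ∈ (lazyP G).charpoly.roots, 0 ≤ μ ∧ μ ≤ 1 := by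
    intro μ hμ
    rw [hroots, Multiset.mem_map] at hμ
    obtain ⟨i, -, rfl⟩ := hμ
    obtain ⟨y, hy0, hy, -⟩ := symLazyP_eigenvalue_exists hd i
    exact ⟨lazyP_eigenvalue_nonneg hd hy hy0, lazyP_eigenvalue_le_one hd hy hy0⟩
  have hcount : (lazyP G).charpoly.roots.count 1 ≤ 1 := by
    rw [hroots, Multiset.count_map]
    change #{i | 1 = (symLazyP_isHermitian G).eigenvalues i} ≤ 1
    refine card_le_one.2 fun i hi j hj => ?_
    exact symLazyP_eigenvalue_one_unique hG hd (mem_filter.1 hi).2.symm (mem_filter.1 hj).2.symm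
  have hcard : 1 < (eigenvalueList (lazyP G)).length := by
    rw [eigenvalueList, Multiset.length_sort, hroots, Multiset.card_map]
    exact Fintype.one_lt_card
  have hcoe : ((eigenvalueList (lazyP G) : List ℝ) : Multiset ℝ) = (lazyP G).charpoly.roots :=
    Multiset.sort_eq _ _
  have hsort : (eigenvalueList (lazyP G)).Pairwise (· ≥ ·) := Multiset.pairwise_sort _ _
  have hone := one_mem_roots_charpoly_lazyP hd
  rw [secondEig]
  rw [← hcoe] at hbound hcount hone ⊢
  generalize eigenvalueList (lazyP G) = L at *
  match L, hcard with
  | a :: b :: l, _ =>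
    simp only [List.pairwise_cons, List.mem_cons] at hsort
    simp only [Multiset.mem_coe, List.mem_cons] at hbound hone
    have ha : a = 1 := by
      refine le_antisymm (hbound a (Or.inl rfl)).2 ?_
      rcases hone with h | h
      · exact h.le
      · exact hsort.1 1 h
    subst ha
    have hb : b ≠ 1 := by
      rintro rfl
      simp at hcount
    refine ⟨(b :: l : List ℝ), rfl, ?_, ?_⟩
    · exact lt_of_le_of_ne (hbound b (by simp)).2 hb
    · intro μ hμ
      simp only [Multiset.mem_coe, List.mem_cons] at hμ
      refine ⟨(hbound μ (Or.inr hμ)).1, ?_⟩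
      rcases hμ with rfl | h
      · simp
      · simpa using hsort.2.1 μ h

end LazyWalk

theorem sum_multiset_map_sum {ι α : Type*} (s : Multiset α) (I : Finset ι) (f : ι → α → ℝ) :
    (s.map fun a => ∑ i ∈ I, f i a).sum = ∑ i ∈ I, (s.map (f i)).sum := by
  induction s using Multiset.induction_on with
  | empty => simp
  | cons a s ih => simp [ih, sum_add_distrib]

/-- The contribution of a single eigenvalue `x`, with `T ≥ 1 / (1 - x)`. -/
theorem geom_sum_sq_le {x : ℝ} {T : ℕ} (hx0 : 0 ≤ x) (hx1 : x < 1) (hT : 1 / (1 - x) ≤ T)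
    (t : ℕ) : (∑ i ∈ range t, x ^ i) ^ 2 ≤
      (T : ℝ) / (1 - 1 / Real.exp 1) ^ 2 * ∑ s ∈ range T, x ^ s := by
  have hx : 0 < 1 - x := by linarith
  have hgeom : ∀ k, ∑ i ∈ range k, x ^ i = (1 - x ^ k) / (1 - x) := fun k => by
    rw [eq_div_iff hx.ne', geom_sum_mul_neg]
  have hc0 : 0 < 1 / Real.exp 1 := by positivity
  have hc1 : 1 / Real.exp 1 < 1 := by
    rw [div_lt_one (Real.exp_pos 1)]
    exact Real.one_lt_exp_iff.2 one_pos
  have hpow : x ^ T ≤ 1 / Real.exp 1 := by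
    rw [one_div, ← Real.exp_neg]
    have h1 : x ≤ Real.exp (-(1 - x)) := by
      linarith [Real.add_one_le_exp (-(1 - x))]
    refine (pow_le_pow_left₀ hx0 h1 T).trans ?_
    rw [← Real.exp_nat_mul]
    apply Real.exp_le_exp.2
    rw [div_le_iff₀ hx] at hT
    linarith
  set c := 1 - 1 / Real.exp 1 with hc
  have hcpos : 0 < c := by linarith
  have hle : ∑ i ∈ range t, x ^ i ≤ 1 / (1 - x) := by
    rw [hgeom]
    gcongr
    linarith [pow_nonneg hx0 t]
  have hge : c / (1 - x) ≤ ∑ s ∈ range T, x ^ s := by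
    rw [hgeom]
    gcongr
    linarith
  have hcc : 1 ≤ 1 / c := by
    rw [one_le_div hcpos]
    linarith
  have hy : 0 < 1 / (1 - x) := by positivity
  calc (∑ i ∈ range t, x ^ i) ^ 2 ≤ (1 / (1 - x)) ^ 2 := by
        gcongr
    _ ≤ (1 / (1 - x)) ^ 2 * (1 / c) := le_mul_of_one_le_right (by positivity) hcc
    _ = (1 / (1 - x)) / c ^ 2 * (c / (1 - x)) := by field_simp
    _ ≤ T / c ^ 2 * ∑ s ∈ range T, x ^ s := by gcongr

/-- For the lazy random walk `P` on a finite connected graph with at least two vertices and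
every `t ≥ 1`:
`∑_{i,j=0}^{t-1} ∑_u P^{i+j}(u,u) ≤ t² + (t_rel/(1-1/e)²) ∑_{s<t_rel} (∑_u P^s(u,u) - 1)`. -/
theorem double_sum_trace_bound
    {V : Type*} [Fintype V] [DecidableEq V] [Nontrivial V]
    (G : SimpleGraph V) [DecidableRel G.Adj] (hG : G.Connected)
    (t : ℕ) (ht : 1 ≤ t) :
    ∑ i ∈ Finset.range t, ∑ j ∈ Finset.range t, ∑ u : V, (lazyP G ^ (i + j)) u u ≤
      (t : ℝ) ^ 2 + ((relTime (lazyP G) : ℝ) / (1 - 1 / Real.exp 1) ^ 2) *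
        ∑ s ∈ Finset.range (relTime (lazyP G)),
          ((∑ u : V, (lazyP G ^ s) u u) - 1) := by
  have hd : ∀ u, 0 < G.degree u := fun u => hG.preconnected.degree_pos_of_nontrivial u
  obtain ⟨s, hs, hlt, hmem⟩ := roots_charpoly_lazyP_eq_cons hG
  have htr : ∀ k, ∑ u : V, (lazyP G ^ k) u u = 1 + (s.map (· ^ k)).sum := fun k => by
    rw [sum_lazyP_pow_diag hd, hs, Multiset.map_cons, Multiset.sum_cons, one_pow]
  have hT : ∀ μ ∈ s, 1 / (1 - μ) ≤ (relTime (lazyP G) : ℝ) := fun μ hμ => by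
    refine le_trans ?_ (Nat.le_ceil _)
    have := (hmem μ hμ).2
    exact one_div_le_one_div_of_le (by linarith) (by linarith)
  simp only [htr, add_sub_cancel_left, sum_add_distrib, sum_const, card_range, nsmul_eq_mul,
    mul_one]
  have hl : ∑ i ∈ range t, ∑ j ∈ range t, (s.map (· ^ (i + j))).sum =
      (s.map fun μ => (∑ i ∈ range t, μ ^ i) ^ 2).sum := by
    simp only [sum_multiset_map_sum, sq, sum_mul_sum, pow_add]
  have hr : ∑ k ∈ range (relTime (lazyP G)), (s.map (· ^ k)).sum =
      (s.map fun μ => ∑ k ∈ range (relTime (lazyP G)), μ ^ k).sum :=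
    (sum_multiset_map_sum s _ _).symm
  rw [hl, hr, ← sq, ← Multiset.sum_map_mul_left]
  refine add_le_add_right (Multiset.sum_map_le_sum_map _ _ fun μ hμ => ?_) _
  exact geom_sum_sq_le (hmem μ hμ).1 ((hmem μ hμ).2.trans_lt hlt) (hT μ hμ) t
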